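/- arXiv:2511.01063 — 10 statements merged into one kernel-verified Lean document; each statement's English description precedes it below -/
import Mathlib

section
/- Let K be a field, M a set, and E a K-vector space. Let v : Fin n → (M → E) be a family of functions and U ⊆ M a subset such that for every x ∈ U the values (v 0 x, …, v (n−1) x) are linearly independent in E. Let w : κ → (M → E) be any family of functions such that each w j lies in the K-linear span of {v 0, …, v (n−1)} (inside the function space M → E) and the family w is linearly independent over K. Then for every x ∈ U the values (w j x) j∈κ are linearly independent in E. In particular, if a finite-dimensional space of vector fields admits a modular basis (a basis whose values are pointwise linearly independent on U), then every basis of it, and every linearly independent family in it, is pointwise linearly independent on U. -/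
/-- If a family of functions `v` has pointwise linearly independent values on `U`, then any
linearly independent family `w` contained in the span of `v` also has pointwise linearly
independent values on `U`.  In particular, every basis of a space of vector fields admitting a
modular basis is again modular. -/
theorem pointwise_linearIndependent_of_mem_span
    {K M E : Type*} [Field K] [AddCommGroup E] [Module K E]
    {n : ℕ} (v : Fin n → (M → E)) (U : Set M)
    (hv : ∀ x ∈ U, LinearIndependent K fun i => v i x)
    {κ : Type*} (w : κ → (M → E))
    (hw_span : ∀ j, w j ∈ Submodule.span K (Set.range v))
    (hw_li : LinearIndependent K w) :
    ∀ x ∈ U, LinearIndependent K fun j => w j x := by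
  intro x hx
  have hdisj : Disjoint (Submodule.span K (Set.range v))
      (LinearMap.ker (LinearMap.proj x : (M → E) →ₗ[K] E)) :=
    Submodule.range_ker_disjoint (hv x hx)
  exact hw_li.map (f := LinearMap.proj x)
    (hdisj.mono_left (Submodule.span_le.mpr (Set.range_subset_iff.mpr hw_span)))
end

section
/- Let A : ℝ → Matrix (Fin n) (Fin n) ℝ and b : ℝ → (Fin n → ℝ) be continuous. Let x, x_p : ℝ → (Fin n → ℝ) be differentiable functions satisfying x'(t) = A(t) *ᵥ x(t) + b(t) and x_p'(t) = A(t) *ᵥ x_p(t) + b(t) for all t, and let x_h : Fin n → (ℝ → (Fin n → ℝ)) be differentiable functions satisfying (x_h i)'(t) = A(t) *ᵥ (x_h i)(t) for all t and all i. Assume that for some t₀ ∈ ℝ the vectors x_h 0 (t₀), …, x_h (n−1) (t₀) are linearly independent in ℝⁿ. Then there exist constants k : Fin n → ℝ such that x(t) = x_p(t) + ∑ i, k i • x_h i (t) for every t ∈ ℝ; that is, every solution of the inhomogeneous linear system is an affine combination of one particular solution of it and n linearly independent solutions of the associated homogeneous system. -/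
open Matrix

/-- Two solutions of the same affine ODE `f' = L(t) f + c(t)` with continuous linear part that
agree at one time agree at all times. -/
theorem eq_of_hasDerivAt_affine {E : Type*} [NormedAddCommGroup E] [NormedSpace ℝ E]
    {L : ℝ → E →L[ℝ] E} (hL : Continuous L) {c f g : ℝ → E}
    (hf : ∀ t, HasDerivAt f (L t (f t) + c t) t) (hg : ∀ t, HasDerivAt g (L t (g t) + c t) t)
    {t₀ : ℝ} (h₀ : f t₀ = g t₀) : f = g := by
  ext t
  obtain ⟨r, hr⟩ : ∃ r, max |t| |t₀| < r := exists_gt _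
  obtain ⟨ht, ht₀⟩ := max_lt_iff.1 hr
  obtain ⟨K, hK⟩ := (isCompact_Icc (a := -r) (b := r)).exists_bound_of_continuousOn
    hL.continuousOn
  refine ODE_solution_unique_of_mem_Ioo (v := fun s y ↦ L s y + c s) (s := fun _ ↦ Set.univ)
    (K := K.toNNReal) (fun s hs ↦ ?_) (abs_lt.1 ht₀) (fun s _ ↦ ⟨hf s, trivial⟩)
    (fun s _ ↦ ⟨hg s, trivial⟩) h₀ (abs_lt.1 ht)
  refine (LipschitzWith.of_dist_le_mul fun y z ↦ ?_).lipschitzOnWith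
  rw [dist_add_right, dist_eq_norm, dist_eq_norm, ← map_sub]
  exact (L s).le_of_opNorm_le
    ((hK s (Set.Ioo_subset_Icc_self hs)).trans (Real.le_coe_toNNReal K)) _

/-- A matrix acting by `mulVec` depends continuously, as a continuous linear map, on the matrix. -/
theorem continuous_toContinuousLinearMap_mulVecLin (n : Type*) [Fintype n] :
    Continuous fun M : Matrix n n ℝ ↦ LinearMap.toContinuousLinearMap M.mulVecLin := by
  classical
  exact (LinearMap.toContinuousLinearMap.toLinearMap ∘ₗ
    (Matrix.toLin' (R := ℝ) (m := n) (n := n)).toLinearMap).continuous_of_finiteDimensional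

/-- Mixed superposition rule for affine (inhomogeneous linear) Lie systems: every solution of
`x' = A(t) x + b(t)` is a particular solution of it plus a constant-coefficient linear
combination of `n` linearly independent solutions of the homogeneous system `x' = A(t) x`. -/
theorem affine_mixed_superposition {n : ℕ}
    (A : ℝ → Matrix (Fin n) (Fin n) ℝ) (b : ℝ → (Fin n → ℝ))
    (hA : Continuous A) (hb : Continuous b)
    (x xp : ℝ → (Fin n → ℝ)) (xh : Fin n → ℝ → (Fin n → ℝ))
    (hx : ∀ t, HasDerivAt x (A t *ᵥ x t + b t) t)
    (hxp : ∀ t, HasDerivAt xp (A t *ᵥ xp t + b t) t)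
    (hxh : ∀ i t, HasDerivAt (xh i) (A t *ᵥ xh i t) t)
    (t₀ : ℝ) (hli : LinearIndependent ℝ fun i => xh i t₀) :
    ∃ k : Fin n → ℝ, ∀ t, x t = xp t + ∑ i, k i • xh i t := by
  obtain ⟨k, hk⟩ : ∃ k : Fin n → ℝ, ∑ i, k i • xh i t₀ = x t₀ - xp t₀ := by
    rw [← Submodule.mem_span_range_iff_exists_fun,
      hli.span_eq_top_of_card_eq_finrank' (by simp)]
    trivial
  refine ⟨k, congrFun ?_⟩
  refine eq_of_hasDerivAt_affine (c := b)
    ((continuous_toContinuousLinearMap_mulVecLin (Fin n)).comp hA) hx (fun t ↦ ?_)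
    (t₀ := t₀) (by simp [hk])
  convert (hxp t).fun_add
    (HasDerivAt.fun_sum (u := Finset.univ) fun i _ ↦ (hxh i t).fun_const_smul (k i)) using 1
  simp [Matrix.mulVec_add, Matrix.mulVec_sum, Matrix.mulVec_smul, add_right_comm]
end

section
/- Let a₁¹, a₁², a₂¹, b₁, b₂ : ℝ → ℝ be functions. Let (x₁,y₁) and (x₂,y₂) be differentiable curves ℝ → ℝ² satisfying the inhomogeneous system dx/dt = a₁¹(t)x + a₁²(t)y + b₁(t), dy/dt = a₂¹(t)x − a₁¹(t)y + b₂(t), and let (x₃,y₃) be a differentiable curve satisfying the homogeneous system dx/dt = a₁¹(t)x + a₁²(t)y, dy/dt = a₂¹(t)x − a₁¹(t)y. Then the function t ↦ (x₃(t)(y₁(t) − y₂(t)) − y₃(t)(x₁(t) − x₂(t)))² is constant on ℝ; i.e., I₁ = (x₃(y₁−y₂) − y₃(x₁−x₂))² is a t-independent constant of motion of the direct product X × X × Y. -/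
/-- `I₁ = (x₃(y₁−y₂) − y₃(x₁−x₂))²` is a time-independent constant of motion of the direct
product `X × X × Y` of two copies of the inhomogeneous Schrödinger system and one copy of its
homogeneous counterpart. -/
theorem schrodinger_I1_constant
    (a11 a12 a21 b1 b2 : ℝ → ℝ)
    (x1 y1 x2 y2 x3 y3 : ℝ → ℝ)
    (hx1 : ∀ t, HasDerivAt x1 (a11 t * x1 t + a12 t * y1 t + b1 t) t)
    (hy1 : ∀ t, HasDerivAt y1 (a21 t * x1 t - a11 t * y1 t + b2 t) t)
    (hx2 : ∀ t, HasDerivAt x2 (a11 t * x2 t + a12 t * y2 t + b1 t) t)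
    (hy2 : ∀ t, HasDerivAt y2 (a21 t * x2 t - a11 t * y2 t + b2 t) t)
    (hx3 : ∀ t, HasDerivAt x3 (a11 t * x3 t + a12 t * y3 t) t)
    (hy3 : ∀ t, HasDerivAt y3 (a21 t * x3 t - a11 t * y3 t) t) :
    ∀ s t : ℝ,
      (x3 s * (y1 s - y2 s) - y3 s * (x1 s - x2 s)) ^ 2
        = (x3 t * (y1 t - y2 t) - y3 t * (x1 t - x2 t)) ^ 2 := by
  have hW : ∀ t, HasDerivAt
      (fun t => x3 t * (y1 t - y2 t) - y3 t * (x1 t - x2 t)) 0 t := fun t => by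
    refine (((hx3 t).fun_mul ((hy1 t).fun_sub (hy2 t))).fun_sub
      ((hy3 t).fun_mul ((hx1 t).fun_sub (hx2 t)))).congr_deriv ?_
    ring
  intro s t
  exact congrArg (· ^ 2)
    (is_const_of_deriv_eq_zero (fun t => (hW t).differentiableAt) (fun t => (hW t).deriv) s t)
end

section
/- Consider the vector fields on ℝ² = ℝ × ℝ given by X₁(x,y) = (x, −y), X₂(x,y) = (y, 0), X₃(x,y) = (0, x), X₄(x,y) = (1, 0), X₅(x,y) = (0, 1). Then at every point of ℝ² their Lie brackets satisfy: [X₁,X₂] = −2X₂, [X₁,X₃] = 2X₃, [X₁,X₄] = −X₄, [X₁,X₅] = X₅, [X₂,X₃] = −X₁, [X₂,X₅] = −X₄, [X₃,X₄] = −X₅, and moreover [X₂,X₄] = 0, [X₃,X₅] = 0, [X₄,X₅] = 0; hence these five vector fields span a Lie algebra of vector fields isomorphic to the Schrödinger algebra S(1) = sl(2,ℝ) ⋉ ℝ². -/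
open VectorField

/-- The vector fields of the Vessiot--Guldberg Lie algebra of the inhomogeneous Schrödinger
Lie system on the plane. -/
def SchX1 : ℝ × ℝ → ℝ × ℝ := fun p => (p.1, -p.2)
def SchX2 : ℝ × ℝ → ℝ × ℝ := fun p => (p.2, 0)
def SchX3 : ℝ × ℝ → ℝ × ℝ := fun p => (0, p.1)
def SchX4 : ℝ × ℝ → ℝ × ℝ := fun _ => (1, 0)
def SchX5 : ℝ × ℝ → ℝ × ℝ := fun _ => (0, 1)

theorem fderiv_SchX1 (p : ℝ × ℝ) :
    fderiv ℝ SchX1 p = (ContinuousLinearMap.fst ℝ ℝ ℝ).prod (-ContinuousLinearMap.snd ℝ ℝ ℝ) :=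
  ((ContinuousLinearMap.fst ℝ ℝ ℝ).prod (-ContinuousLinearMap.snd ℝ ℝ ℝ)).fderiv

theorem fderiv_SchX2 (p : ℝ × ℝ) :
    fderiv ℝ SchX2 p = (ContinuousLinearMap.snd ℝ ℝ ℝ).prod 0 :=
  ((ContinuousLinearMap.snd ℝ ℝ ℝ).prod (0 : ℝ × ℝ →L[ℝ] ℝ)).fderiv

theorem fderiv_SchX3 (p : ℝ × ℝ) :
    fderiv ℝ SchX3 p = (0 : ℝ × ℝ →L[ℝ] ℝ).prod (ContinuousLinearMap.fst ℝ ℝ ℝ) :=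
  ((0 : ℝ × ℝ →L[ℝ] ℝ).prod (ContinuousLinearMap.fst ℝ ℝ ℝ)).fderiv

theorem fderiv_SchX4 (p : ℝ × ℝ) : fderiv ℝ SchX4 p = 0 :=
  fderiv_const_apply _

theorem fderiv_SchX5 (p : ℝ × ℝ) : fderiv ℝ SchX5 p = 0 :=
  fderiv_const_apply _

/-- The commutation relations of the Schrödinger algebra `S(1) = sl(2,ℝ) ⋉ ℝ²` realized by the
vector fields `SchX1, …, SchX5` on `ℝ²`. -/
theorem schrodinger_vf_commutation_relations (p : ℝ × ℝ) :
    lieBracket ℝ SchX1 SchX2 p = (-2 : ℝ) • SchX2 p ∧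
    lieBracket ℝ SchX1 SchX3 p = (2 : ℝ) • SchX3 p ∧
    lieBracket ℝ SchX1 SchX4 p = -SchX4 p ∧
    lieBracket ℝ SchX1 SchX5 p = SchX5 p ∧
    lieBracket ℝ SchX2 SchX3 p = -SchX1 p ∧
    lieBracket ℝ SchX2 SchX5 p = -SchX4 p ∧
    lieBracket ℝ SchX3 SchX4 p = -SchX5 p ∧
    lieBracket ℝ SchX2 SchX4 p = 0 ∧
    lieBracket ℝ SchX3 SchX5 p = 0 ∧
    lieBracket ℝ SchX4 SchX5 p = 0 := by
  simp only [lieBracket, fderiv_SchX1, fderiv_SchX2, fderiv_SchX3, fderiv_SchX4, fderiv_SchX5]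
  refine ⟨?_, ?_, ?_, ?_, ?_, ?_, ?_, ?_, ?_, ?_⟩ <;> ext <;>
    simp [SchX1, SchX2, SchX3, SchX4, SchX5] <;> ring
end

section
/- Consider the vector fields on ℝ³ given by X₁(x,y,z) = (4x², 4xy, −4xz), X₂(x,y,z) = (−1, 0, 0), X₃(x,y,z) = (2x, y, 0), X₄(x,y,z) = (0, 0, −2z). Then at every point of ℝ³ their Lie brackets satisfy [X₁,X₂] = 4X₃ + 2X₄, [X₁,X₃] = −2X₁, [X₂,X₃] = 2X₂, and [X₁,X₄] = [X₂,X₄] = [X₃,X₄] = 0; hence these four vector fields span a four-dimensional Lie algebra isomorphic to sl(2,ℝ) ⊕ ℝ in which X₄ is central. -/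
open VectorField

/-- The vector fields of the Vessiot--Guldberg Lie algebra of the Riccati system on `ℝ³`. -/
def RicX1 : ℝ × ℝ × ℝ → ℝ × ℝ × ℝ := fun p => (4 * p.1 ^ 2, 4 * p.1 * p.2.1, -4 * p.1 * p.2.2)
def RicX2 : ℝ × ℝ × ℝ → ℝ × ℝ × ℝ := fun _ => (-1, 0, 0)
def RicX3 : ℝ × ℝ × ℝ → ℝ × ℝ × ℝ := fun p => (2 * p.1, p.2.1, 0)
def RicX4 : ℝ × ℝ × ℝ → ℝ × ℝ × ℝ := fun p => (0, 0, -2 * p.2.2)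

open ContinuousLinearMap in
theorem fderiv_RicX1_apply (p v : ℝ × ℝ × ℝ) :
    fderiv ℝ RicX1 p v =
      (8 * p.1 * v.1, 4 * (v.1 * p.2.1 + p.1 * v.2.1), -4 * (v.1 * p.2.2 + p.1 * v.2.2)) := by
  have hx : HasFDerivAt (fun q : ℝ × ℝ × ℝ => q.1) (fst ℝ ℝ (ℝ × ℝ)) p := hasFDerivAt_fst
  have hy : HasFDerivAt (fun q : ℝ × ℝ × ℝ => q.2.1) ((fst ℝ ℝ ℝ).comp (snd ℝ ℝ (ℝ × ℝ))) p :=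
    hasFDerivAt_snd.fst
  have hz : HasFDerivAt (fun q : ℝ × ℝ × ℝ => q.2.2) ((snd ℝ ℝ ℝ).comp (snd ℝ ℝ (ℝ × ℝ))) p :=
    hasFDerivAt_snd.snd
  have h : HasFDerivAt RicX1 _ p := ((hx.pow 2).const_mul 4).prodMk
    (((hx.const_mul 4).mul hy).prodMk ((hx.const_mul (-4)).mul hz))
  rw [h.fderiv]
  ext <;> simp <;> ring

theorem fderiv_RicX2_apply (p v : ℝ × ℝ × ℝ) : fderiv ℝ RicX2 p v = 0 := by
  have h : HasFDerivAt (𝕜 := ℝ) RicX2 0 p := hasFDerivAt_const _ p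
  rw [h.fderiv, zero_apply]

theorem fderiv_RicX3_apply (p v : ℝ × ℝ × ℝ) : fderiv ℝ RicX3 p v = RicX3 v := by
  have h : HasFDerivAt RicX3 _ p := ((hasFDerivAt_fst (𝕜 := ℝ) (p := p)).const_mul 2).prodMk
    (hasFDerivAt_snd.fst.prodMk (hasFDerivAt_const 0 p))
  rw [h.fderiv]
  simp [RicX3]

theorem fderiv_RicX4_apply (p v : ℝ × ℝ × ℝ) : fderiv ℝ RicX4 p v = RicX4 v := by
  have h : HasFDerivAt RicX4 _ p := (hasFDerivAt_const 0 p).prodMk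
    ((hasFDerivAt_const 0 p).prodMk ((hasFDerivAt_snd (𝕜 := ℝ) (p := p)).snd.const_mul (-2)))
  rw [h.fderiv]
  simp [RicX4]

/-- The commutation relations of the Vessiot--Guldberg Lie algebra `sl(2,ℝ) ⊕ ℝ`
(with central element `RicX4`) of the Riccati system on `ℝ³`. -/
theorem riccati_vf_commutation_relations (p : ℝ × ℝ × ℝ) :
    lieBracket ℝ RicX1 RicX2 p = (4 : ℝ) • RicX3 p + (2 : ℝ) • RicX4 p ∧
    lieBracket ℝ RicX1 RicX3 p = (-2 : ℝ) • RicX1 p ∧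
    lieBracket ℝ RicX2 RicX3 p = (2 : ℝ) • RicX2 p ∧
    lieBracket ℝ RicX1 RicX4 p = 0 ∧
    lieBracket ℝ RicX2 RicX4 p = 0 ∧
    lieBracket ℝ RicX3 RicX4 p = 0 := by
  simp only [lieBracket, fderiv_RicX1_apply, fderiv_RicX2_apply, fderiv_RicX3_apply,
    fderiv_RicX4_apply]
  refine ⟨?_, ?_, ?_, ?_, ?_, ?_⟩ <;> ext <;> simp [RicX1, RicX2, RicX3, RicX4] <;> ring
end

section
/- On the set {(x,y) ∈ ℝ² : y ≠ 0}, define the Poisson bracket {f,g}_ω = (y³/2)(∂f/∂x · ∂g/∂y − ∂f/∂y · ∂g/∂x) (the bracket induced by the symplectic form ω = (2/y³) dx ∧ dy), and the functions h₁(x,y) = −4x²/y², h₂(x,y) = 1/y², h₃(x,y) = −2x/y² − 1, h₄(x,y) = 2. Then at every point with y ≠ 0: {h₁,h₂}_ω = −4h₃ − 2h₄, {h₁,h₃}_ω = 2h₁, {h₂,h₃}_ω = −2h₂, and all brackets involving h₄ vanish. -/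
/-- The Poisson bracket on `{(x,y) ∈ ℝ² : y ≠ 0}` induced by the symplectic form
`ω = (2/y³) dx ∧ dy`, namely `{f,g}_ω = (y³/2)(∂f/∂x ∂g/∂y − ∂f/∂y ∂g/∂x)`. -/
noncomputable def pbOmega (f g : ℝ × ℝ → ℝ) (p : ℝ × ℝ) : ℝ :=
  (p.2 ^ 3 / 2) *
    (fderiv ℝ f p (1, 0) * fderiv ℝ g p (0, 1) - fderiv ℝ f p (0, 1) * fderiv ℝ g p (1, 0))

/-- The contact Hamiltonian functions of the Riccati system projected to the symplectic
quotient. -/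
noncomputable def rh1 : ℝ × ℝ → ℝ := fun p => -4 * p.1 ^ 2 / p.2 ^ 2
noncomputable def rh2 : ℝ × ℝ → ℝ := fun p => 1 / p.2 ^ 2
noncomputable def rh3 : ℝ × ℝ → ℝ := fun p => -2 * p.1 / p.2 ^ 2 - 1
noncomputable def rh4 : ℝ × ℝ → ℝ := fun _ => 2

theorem hasFDerivAt_quadratic_fst_div_snd_sq (p : ℝ × ℝ) (hp : p.2 ≠ 0) (a b c d : ℝ) :
    HasFDerivAt (fun q : ℝ × ℝ => (a * q.1 ^ 2 + b * q.1 + c) / q.2 ^ 2 + d)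
      (((2 * a * p.1 + b) / p.2 ^ 2) • ContinuousLinearMap.fst ℝ ℝ ℝ +
        (-2 * (a * p.1 ^ 2 + b * p.1 + c) / p.2 ^ 3) • ContinuousLinearMap.snd ℝ ℝ ℝ) p := by
  have hx : HasFDerivAt (fun q : ℝ × ℝ => q.1) (ContinuousLinearMap.fst ℝ ℝ ℝ) p :=
    hasFDerivAt_fst
  have hy : HasFDerivAt (fun q : ℝ × ℝ => q.2) (ContinuousLinearMap.snd ℝ ℝ ℝ) p :=
    hasFDerivAt_snd
  have hu : HasDerivAt (fun x : ℝ => a * x ^ 2 + b * x + c) (2 * a * p.1 + b) p.1 := by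
    refine (((((hasDerivAt_id' p.1).fun_pow 2).const_mul a).fun_add
      ((hasDerivAt_id' p.1).const_mul b)).add_const c).congr_deriv ?_
    simp only [Nat.cast_ofNat, Nat.add_one_sub_one, pow_one, mul_one]
    ring
  have hv : HasDerivAt (fun y : ℝ => (y ^ 2)⁻¹) (-2 / p.2 ^ 3) p.2 := by
    refine (((hasDerivAt_id' p.2).fun_pow 2).fun_inv (pow_ne_zero 2 hp)).congr_deriv ?_
    field_simp
    norm_num [mul_comm]
  refine (((hu.comp_hasFDerivAt p hx).mul (hv.comp_hasFDerivAt p hy)).add_const d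
    |>.congr_of_eventuallyEq (.of_forall fun q => ?_)).congr_fderiv ?_
  · simp [div_eq_mul_inv]
  · ext <;> simp <;> ring

/-- Commutation relations of the projected Hamiltonian functions with respect to the Poisson
bracket induced by `ω = (2/y³) dx ∧ dy`, mirroring the Vessiot--Guldberg Lie algebra
`sl(2,ℝ) ⊕ ℝ` of the Riccati system. -/
theorem riccati_hamiltonian_commutation_relations (p : ℝ × ℝ) (hp : p.2 ≠ 0) :
    pbOmega rh1 rh2 p = -4 * rh3 p - 2 * rh4 p ∧
    pbOmega rh1 rh3 p = 2 * rh1 p ∧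
    pbOmega rh2 rh3 p = -2 * rh2 p ∧
    pbOmega rh1 rh4 p = 0 ∧
    pbOmega rh2 rh4 p = 0 ∧
    pbOmega rh3 rh4 p = 0 := by
  have h1 :=
    (hasFDerivAt_quadratic_fst_div_snd_sq p hp (-4) 0 0 0).congr_of_eventuallyEq
      (f₁ := rh1) (.of_forall fun q => by simp [rh1])
  have h2 :=
    (hasFDerivAt_quadratic_fst_div_snd_sq p hp 0 0 1 0).congr_of_eventuallyEq
      (f₁ := rh2) (.of_forall fun q => by simp [rh2])
  have h3 :=
    (hasFDerivAt_quadratic_fst_div_snd_sq p hp 0 (-2) 0 (-1)).congr_of_eventuallyEq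
      (f₁ := rh3) (.of_forall fun q => by simp [rh3, sub_eq_add_neg])
  have h4 : HasFDerivAt rh4 (0 : ℝ × ℝ →L[ℝ] ℝ) p := hasFDerivAt_const 2 p
  simp only [pbOmega, h1.fderiv, h2.fderiv, h3.fderiv, h4.fderiv]
  refine ⟨?_, ?_, ?_, ?_, ?_, ?_⟩ <;> simp [rh1, rh2, rh3, rh4] <;> field_simp <;> ring
end

section
/- Let b₁, b₂, b₃, b₄ : ℝ → ℝ be functions. Let (x₁,y₁,z₁) and (x₂,y₂,z₂) be differentiable solutions of the Riccati system dx/dt = −b₂(t) + 2b₃(t)x + 4b₁(t)x², dy/dt = (b₃(t) + 4b₁(t)x)y, dz/dt = −(4b₁(t)x + 2b₄(t))z, and let x₃ be a differentiable solution of the Riccati equation dx/dt = −b₂(t) + 2b₃(t)x + 4b₁(t)x². Assume that for all t: y₁(t) ≠ 0, y₂(t) ≠ 0, z₁(t) ≠ 0, x₁(t) ≠ x₂(t), x₁(t) ≠ x₃(t), x₂(t) ≠ x₃(t). Then the three functions I₁(t) = y₁(x₂ − x₃)/(y₂(x₁ − x₃)), I₂(t) = z₂(x₁ − x₂)/(z₁y₁²),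 I₃(t) = y₁y₂/(x₁ − x₂) are constant on ℝ; i.e., they are t-independent constants of motion of the direct product X^[2] × π_*X. -/
/-- Two solutions of the same scalar linear homogeneous equation have a constant ratio. -/
theorem div_eq_div_of_hasDerivAt_mul {f g p : ℝ → ℝ}
    (hf : ∀ t, HasDerivAt f (p t * f t) t) (hg : ∀ t, HasDerivAt g (p t * g t) t)
    (hg0 : ∀ t, g t ≠ 0) (s t : ℝ) : f s / g s = f t / g t := by
  have h : ∀ t, HasDerivAt (fun t => f t / g t) 0 t := fun t =>
    ((hf t).fun_div (hg t) (hg0 t)).congr_deriv (by ring)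
  exact is_const_of_deriv_eq_zero (fun t => (h t).differentiableAt) (fun t => (h t).deriv) s t

/-- The difference of two solutions of a Riccati equation solves a linear homogeneous equation. -/
theorem hasDerivAt_sub_of_riccati {a b c x y : ℝ → ℝ} {t : ℝ}
    (hx : HasDerivAt x (-a t + 2 * b t * x t + 4 * c t * x t ^ 2) t)
    (hy : HasDerivAt y (-a t + 2 * b t * y t + 4 * c t * y t ^ 2) t) :
    HasDerivAt (fun t => x t - y t) ((2 * b t + 4 * c t * (x t + y t)) * (x t - y t)) t :=
  (hx.fun_sub hy).congr_deriv (by ring)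

/-- The functions `I₁, I₂, I₃` are time-independent constants of motion of the direct product
`X^{[2]} × π_*X` of two copies of the Riccati system and one copy of the Riccati equation. -/
theorem riccati_constants_of_motion
    (b1 b2 b3 b4 : ℝ → ℝ)
    (x1 y1 z1 x2 y2 z2 x3 : ℝ → ℝ)
    (hx1 : ∀ t, HasDerivAt x1 (-b2 t + 2 * b3 t * x1 t + 4 * b1 t * x1 t ^ 2) t)
    (hy1 : ∀ t, HasDerivAt y1 ((b3 t + 4 * b1 t * x1 t) * y1 t) t)
    (hz1 : ∀ t, HasDerivAt z1 (-(4 * b1 t * x1 t + 2 * b4 t) * z1 t) t)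
    (hx2 : ∀ t, HasDerivAt x2 (-b2 t + 2 * b3 t * x2 t + 4 * b1 t * x2 t ^ 2) t)
    (hy2 : ∀ t, HasDerivAt y2 ((b3 t + 4 * b1 t * x2 t) * y2 t) t)
    (hz2 : ∀ t, HasDerivAt z2 (-(4 * b1 t * x2 t + 2 * b4 t) * z2 t) t)
    (hx3 : ∀ t, HasDerivAt x3 (-b2 t + 2 * b3 t * x3 t + 4 * b1 t * x3 t ^ 2) t)
    (hy1ne : ∀ t, y1 t ≠ 0) (hy2ne : ∀ t, y2 t ≠ 0) (hz1ne : ∀ t, z1 t ≠ 0)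
    (h12 : ∀ t, x1 t ≠ x2 t) (h13 : ∀ t, x1 t ≠ x3 t) (h23 : ∀ t, x2 t ≠ x3 t) :
    (∀ s t : ℝ, y1 s * (x2 s - x3 s) / (y2 s * (x1 s - x3 s))
        = y1 t * (x2 t - x3 t) / (y2 t * (x1 t - x3 t))) ∧
      (∀ s t : ℝ, z2 s * (x1 s - x2 s) / (z1 s * y1 s ^ 2)
        = z2 t * (x1 t - x2 t) / (z1 t * y1 t ^ 2)) ∧
      (∀ s t : ℝ, y1 s * y2 s / (x1 s - x2 s) = y1 t * y2 t / (x1 t - x2 t)) := by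
  refine ⟨?_, ?_, ?_⟩
  · refine div_eq_div_of_hasDerivAt_mul (p := fun t => 3 * b3 t + 4 * b1 t * (x1 t + x2 t + x3 t))
      (fun t => ?_) (fun t => ?_) fun t => mul_ne_zero (hy2ne t) (sub_ne_zero.2 (h13 t))
    · exact ((hy1 t).fun_mul (hasDerivAt_sub_of_riccati (hx2 t) (hx3 t))).congr_deriv (by ring)
    · exact ((hy2 t).fun_mul (hasDerivAt_sub_of_riccati (hx1 t) (hx3 t))).congr_deriv (by ring)
  · refine div_eq_div_of_hasDerivAt_mul (p := fun t => 2 * b3 t + 4 * b1 t * x1 t - 2 * b4 t)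
      (fun t => ?_) (fun t => ?_) fun t => mul_ne_zero (hz1ne t) (pow_ne_zero 2 (hy1ne t))
    · exact ((hz2 t).fun_mul (hasDerivAt_sub_of_riccati (hx1 t) (hx2 t))).congr_deriv (by ring)
    · exact ((hz1 t).fun_mul ((hy1 t).fun_pow 2)).congr_deriv (by ring)
  · refine div_eq_div_of_hasDerivAt_mul (p := fun t => 2 * b3 t + 4 * b1 t * (x1 t + x2 t))
      (fun t => ?_) (fun t => hasDerivAt_sub_of_riccati (hx1 t) (hx2 t))
      fun t => sub_ne_zero.2 (h12 t)
    exact ((hy1 t).fun_mul (hy2 t)).congr_deriv (by ring)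
end

section
/- Let b₁, b₂, b₃, b₄ : ℝ → ℝ be functions, let (x₂,y₂,z₂) be a differentiable solution of the Riccati system dx/dt = −b₂(t) + 2b₃(t)x + 4b₁(t)x², dy/dt = (b₃(t) + 4b₁(t)x)y, dz/dt = −(4b₁(t)x + 2b₄(t))z, and let x₃ be a differentiable solution of the Riccati equation dx/dt = −b₂(t) + 2b₃(t)x + 4b₁(t)x². Let k₁, k₂, k₃ be nonzero real constants and assume that for all t: x₂(t) ≠ x₃(t) and k₃(x₂(t) − x₃(t)) − k₁y₂(t)² ≠ 0. Then the curve x₁(t) = x₂ + k₁(x₂ − x₃)y₂²/(k₃(x₂ − x₃) − k₁y₂²), y₁(t) = k₁k₃ y₂ (x₂ − x₃)/(k₃(x₂ − x₃) − k₁y₂²), z₁(t) = (z₂/(k₂k₃)) · (1/k₁ − y₂²/(k₃(x₂ − x₃))) is again a solution of the Riccati system. -/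
/-- Mixed superposition rule for the Riccati system: from one particular solution
`(x₂,y₂,z₂)` of the Riccati system, one particular solution `x₃` of the Riccati equation and
three nonzero constants `k₁,k₂,k₃`, the displayed formulas give again a solution of the Riccati
system. -/
theorem riccati_mixed_superposition
    (b1 b2 b3 b4 : ℝ → ℝ)
    (x2 y2 z2 x3 : ℝ → ℝ)
    (hx2 : ∀ t, HasDerivAt x2 (-b2 t + 2 * b3 t * x2 t + 4 * b1 t * x2 t ^ 2) t)
    (hy2 : ∀ t, HasDerivAt y2 ((b3 t + 4 * b1 t * x2 t) * y2 t) t)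
    (hz2 : ∀ t, HasDerivAt z2 (-(4 * b1 t * x2 t + 2 * b4 t) * z2 t) t)
    (hx3 : ∀ t, HasDerivAt x3 (-b2 t + 2 * b3 t * x3 t + 4 * b1 t * x3 t ^ 2) t)
    (k1 k2 k3 : ℝ) (hk1 : k1 ≠ 0) (hk2 : k2 ≠ 0) (hk3 : k3 ≠ 0)
    (h23 : ∀ t, x2 t ≠ x3 t)
    (hden : ∀ t, k3 * (x2 t - x3 t) - k1 * y2 t ^ 2 ≠ 0) :
    (∀ t, HasDerivAt
        (fun t => x2 t + k1 * (x2 t - x3 t) * y2 t ^ 2 / (k3 * (x2 t - x3 t) - k1 * y2 t ^ 2))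
        (-b2 t + 2 * b3 t *
            (x2 t + k1 * (x2 t - x3 t) * y2 t ^ 2 / (k3 * (x2 t - x3 t) - k1 * y2 t ^ 2))
          + 4 * b1 t *
            (x2 t + k1 * (x2 t - x3 t) * y2 t ^ 2
              / (k3 * (x2 t - x3 t) - k1 * y2 t ^ 2)) ^ 2) t) ∧
      (∀ t, HasDerivAt
        (fun t => k1 * k3 * y2 t * (x2 t - x3 t) / (k3 * (x2 t - x3 t) - k1 * y2 t ^ 2))
        ((b3 t + 4 * b1 t *
            (x2 t + k1 * (x2 t - x3 t) * y2 t ^ 2 / (k3 * (x2 t - x3 t) - k1 * y2 t ^ 2)))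
          * (k1 * k3 * y2 t * (x2 t - x3 t) / (k3 * (x2 t - x3 t) - k1 * y2 t ^ 2))) t) ∧
      (∀ t, HasDerivAt
        (fun t => z2 t / (k2 * k3) * (1 / k1 - y2 t ^ 2 / (k3 * (x2 t - x3 t))))
        (-(4 * b1 t *
            (x2 t + k1 * (x2 t - x3 t) * y2 t ^ 2 / (k3 * (x2 t - x3 t) - k1 * y2 t ^ 2))
            + 2 * b4 t)
          * (z2 t / (k2 * k3) * (1 / k1 - y2 t ^ 2 / (k3 * (x2 t - x3 t))))) t) := by
  have hu (t : ℝ) := (hx2 t).sub (hx3 t)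
  have hw (t : ℝ) := (hy2 t).pow 2
  have hD (t : ℝ) := ((hu t).const_mul k3).sub ((hw t).const_mul k1)
  have hu0 (t : ℝ) : x2 t - x3 t ≠ 0 := sub_ne_zero.2 (h23 t)
  refine ⟨fun t => ?_, fun t => ?_, fun t => ?_⟩
  · refine ((hx2 t).add ((((hu t).const_mul k1).mul (hw t)).div (hD t) (hden t))).congr_deriv ?_
    have h := hden t
    simp only [Pi.sub_apply, Pi.mul_apply, Pi.pow_apply]
    generalize hd : k3 * (x2 t - x3 t) - k1 * y2 t ^ 2 = d at h ⊢
    field_simp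
    rw [← hd]
    ring
  · refine ((((hy2 t).const_mul (k1 * k3)).mul (hu t)).div (hD t) (hden t)).congr_deriv ?_
    have h := hden t
    simp only [Pi.sub_apply, Pi.mul_apply, Pi.pow_apply]
    field_simp
    ring
  · refine (((hz2 t).div_const (k2 * k3)).mul (((hw t).div ((hu t).const_mul k3)
      (mul_ne_zero hk3 (hu0 t))).const_sub (1 / k1))).congr_deriv ?_
    have h := hden t
    have h' := hu0 t
    simp only [Pi.sub_apply, Pi.div_apply, Pi.pow_apply]
    field_simp
    ring
end

section
/- Let b₁, …, b₆ : ℝ → ℝ be functions and let (U, S, ν, T, P) be a differentiable curve satisfying the thermodynamic system dU/dt = −(b₁ − b₆)U + b₃ν + b₅S, dS/dt = b₆S, dν/dt = b₂U + (b₁ + b₆)ν + b₄S, dT/dt = −b₁T + b₂TP + b₄P + b₅, dP/dt = b₂P² − 2b₁P − b₃. Then the Gibbs free energy G(t) = U(t) + P(t)ν(t) − S(t)T(t) satisfies the differential equation dG/dt = −(b₁(t) − b₆(t) − b₂(t)P(t))·G(t) for all t. In particular, if G(t₀) = 0 for some t₀ and the coefficients and P are continuous, then G vanishes identically. -/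
/-- A solution of a scalar homogeneous linear ODE with continuous coefficient that vanishes at one
time vanishes identically. -/
theorem eq_zero_of_hasDerivAt_mul_self {a g : ℝ → ℝ} (ha : Continuous a)
    (hg : ∀ t, HasDerivAt g (a t * g t) t) {t₀ : ℝ} (h₀ : g t₀ = 0) (t : ℝ) : g t = 0 := by
  have hA : ∀ s, HasDerivAt (fun s => ∫ x in t₀..s, a x) (a s) s := fun s =>
    intervalIntegral.integral_hasDerivAt_right (ha.intervalIntegrable _ _)
      (ha.stronglyMeasurableAtFilter _ _) ha.continuousAt
  have hF : ∀ s, HasDerivAt (fun s => g s * Real.exp (-∫ x in t₀..s, a x)) 0 s := fun s => by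
    refine ((hg s).mul (hA s).neg.exp).congr_deriv ?_
    simp only [Pi.neg_apply]
    ring
  have hconst := is_const_of_deriv_eq_zero (fun s => (hF s).differentiableAt)
    (fun s => (hF s).deriv) t t₀
  simpa [h₀, Real.exp_ne_zero] using hconst

/-- Along any solution of the time-dependent thermodynamic Lie system, the Gibbs free energy
`G = U + Pν − ST` satisfies `dG/dt = −(b₁ − b₆ − b₂P)G`; in particular, if the coefficients and
`P` are continuous and `G` vanishes at some time, then `G` vanishes identically. -/
theorem thermodynamic_gibbs_free_energy
    (b1 b2 b3 b4 b5 b6 : ℝ → ℝ)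
    (U S nu T P : ℝ → ℝ)
    (hU : ∀ t, HasDerivAt U (-(b1 t - b6 t) * U t + b3 t * nu t + b5 t * S t) t)
    (hS : ∀ t, HasDerivAt S (b6 t * S t) t)
    (hnu : ∀ t, HasDerivAt nu (b2 t * U t + (b1 t + b6 t) * nu t + b4 t * S t) t)
    (hT : ∀ t, HasDerivAt T (-(b1 t) * T t + b2 t * T t * P t + b4 t * P t + b5 t) t)
    (hP : ∀ t, HasDerivAt P (b2 t * P t ^ 2 - 2 * b1 t * P t - b3 t) t) :
    (∀ t, HasDerivAt (fun t => U t + P t * nu t - S t * T t)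
        (-(b1 t - b6 t - b2 t * P t) * (U t + P t * nu t - S t * T t)) t) ∧
      (Continuous b1 → Continuous b2 → Continuous b3 → Continuous b4 → Continuous b5 →
        Continuous b6 → Continuous P →
        ∀ t₀, U t₀ + P t₀ * nu t₀ - S t₀ * T t₀ = 0 →
          ∀ t, U t + P t * nu t - S t * T t = 0) := by
  have hG : ∀ t, HasDerivAt (fun t => U t + P t * nu t - S t * T t)
      (-(b1 t - b6 t - b2 t * P t) * (U t + P t * nu t - S t * T t)) t := fun t => by
    refine (((hU t).add ((hP t).mul (hnu t))).sub ((hS t).mul (hT t))).congr_deriv ?_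
    ring
  refine ⟨hG, fun h1 h2 _ _ _ h6 hPc t₀ h₀ t => ?_⟩
  exact eq_zero_of_hasDerivAt_mul_self ((h1.sub h6).sub (h2.mul hPc)).neg hG h₀ t
end

section
/- Let c ∈ ℝ and consider, on the open set {(q₁,q₂,p₁,p₂) ∈ ℝ⁴ : q₁ ≠ q₂}, the functions h₁ = q₁p₁ + q₂p₂, h₂ = ½(p₁² + p₂² + c/(q₁ − q₂)²), h₃ = −½(q₁² + q₂²), h₄ = p₁ + p₂, h₅ = −q₁ − q₂, h₀ = 2, and the canonical Poisson bracket {f,g} = ∑_{i=1}^{2} (∂f/∂q_i · ∂g/∂p_i − ∂f/∂p_i · ∂g/∂q_i). Then at every point with q₁ ≠ q₂: {h₁,h₂} = 2h₂, {h₁,h₃} = −2h₃, {h₁,h₄} = h₄, {h₁,h₅} = −h₅, {h₂,h₃} = h₁, {h₂,h₅} = h₄, {h₃,h₄} = h₅, {h₄,h₅} = h₀; hence these functions close a Lie algebra isomorphic to the centrally extended Schrödinger algebra. -/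
/-- The canonical Poisson bracket on `ℝ⁴` with coordinates `(q₁, q₂, p₁, p₂)`:
`{f,g} = ∑ᵢ (∂f/∂qᵢ ∂g/∂pᵢ − ∂f/∂pᵢ ∂g/∂qᵢ)`. -/
noncomputable def canonicalPB (f g : ℝ × ℝ × ℝ × ℝ → ℝ) (z : ℝ × ℝ × ℝ × ℝ) : ℝ :=
  fderiv ℝ f z (1, 0, 0, 0) * fderiv ℝ g z (0, 0, 1, 0)
    - fderiv ℝ f z (0, 0, 1, 0) * fderiv ℝ g z (1, 0, 0, 0)
    + (fderiv ℝ f z (0, 1, 0, 0) * fderiv ℝ g z (0, 0, 0, 1)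
      - fderiv ℝ f z (0, 0, 0, 1) * fderiv ℝ g z (0, 1, 0, 0))

/-- The Hamiltonian functions of the time-dependent two-body rational Calogero–Moser system
with coupling constant `c`, on the set `q₁ ≠ q₂`; here `z = (q₁, q₂, p₁, p₂)`. -/
noncomputable def cmh1 : ℝ × ℝ × ℝ × ℝ → ℝ := fun z => z.1 * z.2.2.1 + z.2.1 * z.2.2.2
noncomputable def cmh2 (c : ℝ) : ℝ × ℝ × ℝ × ℝ → ℝ :=
  fun z => (1 / 2) * (z.2.2.1 ^ 2 + z.2.2.2 ^ 2 + c / (z.1 - z.2.1) ^ 2)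
noncomputable def cmh3 : ℝ × ℝ × ℝ × ℝ → ℝ := fun z => -(1 / 2) * (z.1 ^ 2 + z.2.1 ^ 2)
noncomputable def cmh4 : ℝ × ℝ × ℝ × ℝ → ℝ := fun z => z.2.2.1 + z.2.2.2
noncomputable def cmh5 : ℝ × ℝ × ℝ × ℝ → ℝ := fun z => -z.1 - z.2.1
noncomputable def cmh0 : ℝ × ℝ × ℝ × ℝ → ℝ := fun _ => 2

/-- The continuous linear functional on `ℝ⁴` with coefficients `a₁, a₂, b₁, b₂`. -/
noncomputable def covector (a₁ a₂ b₁ b₂ : ℝ) : ℝ × ℝ × ℝ × ℝ →L[ℝ] ℝ :=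
  (a₁ • ContinuousLinearMap.id ℝ ℝ).coprod ((a₂ • ContinuousLinearMap.id ℝ ℝ).coprod
    ((b₁ • ContinuousLinearMap.id ℝ ℝ).coprod (b₂ • ContinuousLinearMap.id ℝ ℝ)))

@[simp]
theorem covector_apply (a₁ a₂ b₁ b₂ : ℝ) (v : ℝ × ℝ × ℝ × ℝ) :
    covector a₁ a₂ b₁ b₂ v = a₁ * v.1 + (a₂ * v.2.1 + (b₁ * v.2.2.1 + b₂ * v.2.2.2)) := by
  simp [covector]

theorem canonicalPB_eq_of_hasFDerivAt {f g : ℝ × ℝ × ℝ × ℝ → ℝ} {z : ℝ × ℝ × ℝ × ℝ}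
    {a₁ a₂ b₁ b₂ a₁' a₂' b₁' b₂' : ℝ} (hf : HasFDerivAt f (covector a₁ a₂ b₁ b₂) z)
    (hg : HasFDerivAt g (covector a₁' a₂' b₁' b₂') z) :
    canonicalPB f g z = a₁ * b₁' - b₁ * a₁' + (a₂ * b₂' - b₂ * a₂') := by
  simp [canonicalPB, hf.fderiv, hg.fderiv]

theorem hasFDerivAt_q₁ (z : ℝ × ℝ × ℝ × ℝ) :
    HasFDerivAt (fun w : ℝ × ℝ × ℝ × ℝ => w.1) (covector 1 0 0 0) z :=
  (covector 1 0 0 0).hasFDerivAt.congr_of_eventuallyEq (.of_forall fun w => by simp)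

theorem hasFDerivAt_q₂ (z : ℝ × ℝ × ℝ × ℝ) :
    HasFDerivAt (fun w : ℝ × ℝ × ℝ × ℝ => w.2.1) (covector 0 1 0 0) z :=
  (covector 0 1 0 0).hasFDerivAt.congr_of_eventuallyEq (.of_forall fun w => by simp)

theorem hasFDerivAt_p₁ (z : ℝ × ℝ × ℝ × ℝ) :
    HasFDerivAt (fun w : ℝ × ℝ × ℝ × ℝ => w.2.2.1) (covector 0 0 1 0) z :=
  (covector 0 0 1 0).hasFDerivAt.congr_of_eventuallyEq (.of_forall fun w => by simp)

theorem hasFDerivAt_p₂ (z : ℝ × ℝ × ℝ × ℝ) :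
    HasFDerivAt (fun w : ℝ × ℝ × ℝ × ℝ => w.2.2.2) (covector 0 0 0 1) z :=
  (covector 0 0 0 1).hasFDerivAt.congr_of_eventuallyEq (.of_forall fun w => by simp)

theorem hasFDerivAt_cmh1 (z : ℝ × ℝ × ℝ × ℝ) :
    HasFDerivAt cmh1 (covector z.2.2.1 z.2.2.2 z.1 z.2.1) z := by
  refine (((hasFDerivAt_q₁ z).mul (hasFDerivAt_p₁ z)).add
    ((hasFDerivAt_q₂ z).mul (hasFDerivAt_p₂ z))).congr_fderiv ?_
  refine ContinuousLinearMap.ext fun v => ?_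
  simp
  ring

theorem hasFDerivAt_cmh2 (c : ℝ) {z : ℝ × ℝ × ℝ × ℝ} (hz : z.1 ≠ z.2.1) :
    HasFDerivAt (cmh2 c) (covector (-c / (z.1 - z.2.1) ^ 3) (c / (z.1 - z.2.1) ^ 3)
      z.2.2.1 z.2.2.2) z := by
  have hsub : z.1 - z.2.1 ≠ 0 := sub_ne_zero.mpr hz
  have hpot : HasDerivAt (fun x : ℝ => c / x ^ 2) (-2 * c / (z.1 - z.2.1) ^ 3)
      (z.1 - z.2.1) := by
    refine ((hasDerivAt_const _ c).div (hasDerivAt_pow 2 _) (pow_ne_zero 2 hsub)).congr_deriv ?_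
    field_simp
    norm_num
    ring
  refine (((((hasFDerivAt_p₁ z).pow 2).add ((hasFDerivAt_p₂ z).pow 2)).add
    (hpot.comp_hasFDerivAt z ((hasFDerivAt_q₁ z).sub (hasFDerivAt_q₂ z)))).const_mul
      (1 / 2)).congr_fderiv ?_
  refine ContinuousLinearMap.ext fun v => ?_
  simp
  ring

theorem hasFDerivAt_cmh3 (z : ℝ × ℝ × ℝ × ℝ) :
    HasFDerivAt cmh3 (covector (-z.1) (-z.2.1) 0 0) z := by
  refine ((((hasFDerivAt_q₁ z).pow 2).add ((hasFDerivAt_q₂ z).pow 2)).const_mul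
    (-(1 / 2))).congr_fderiv ?_
  refine ContinuousLinearMap.ext fun v => ?_
  simp
  ring

theorem hasFDerivAt_cmh4 (z : ℝ × ℝ × ℝ × ℝ) : HasFDerivAt cmh4 (covector 0 0 1 1) z := by
  refine ((hasFDerivAt_p₁ z).add (hasFDerivAt_p₂ z)).congr_fderiv ?_
  refine ContinuousLinearMap.ext fun v => ?_
  simp

theorem hasFDerivAt_cmh5 (z : ℝ × ℝ × ℝ × ℝ) : HasFDerivAt cmh5 (covector (-1) (-1) 0 0) z := by
  refine ((hasFDerivAt_q₁ z).neg.sub (hasFDerivAt_q₂ z)).congr_fderiv ?_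
  refine ContinuousLinearMap.ext fun v => ?_
  simp
  ring

/-- The Hamiltonian functions of the Calogero–Moser system with external force close a Lie
algebra isomorphic to the centrally extended Schrödinger algebra, with respect to the canonical
Poisson bracket, at every point with `q₁ ≠ q₂`. -/
theorem calogeroMoser_hamiltonian_relations (c : ℝ) (z : ℝ × ℝ × ℝ × ℝ) (hz : z.1 ≠ z.2.1) :
    canonicalPB cmh1 (cmh2 c) z = 2 * cmh2 c z ∧
    canonicalPB cmh1 cmh3 z = -2 * cmh3 z ∧
    canonicalPB cmh1 cmh4 z = cmh4 z ∧
    canonicalPB cmh1 cmh5 z = -cmh5 z ∧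
    canonicalPB (cmh2 c) cmh3 z = cmh1 z ∧
    canonicalPB (cmh2 c) cmh5 z = cmh4 z ∧
    canonicalPB cmh3 cmh4 z = cmh5 z ∧
    canonicalPB cmh4 cmh5 z = cmh0 z := by
  have hsub : z.1 - z.2.1 ≠ 0 := sub_ne_zero.mpr hz
  have d1 := hasFDerivAt_cmh1 z
  have d2 := hasFDerivAt_cmh2 c hz
  have d3 := hasFDerivAt_cmh3 z
  have d4 := hasFDerivAt_cmh4 z
  have d5 := hasFDerivAt_cmh5 z
  rw [canonicalPB_eq_of_hasFDerivAt d1 d2, canonicalPB_eq_of_hasFDerivAt d1 d3,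
    canonicalPB_eq_of_hasFDerivAt d1 d4, canonicalPB_eq_of_hasFDerivAt d1 d5,
    canonicalPB_eq_of_hasFDerivAt d2 d3, canonicalPB_eq_of_hasFDerivAt d2 d5,
    canonicalPB_eq_of_hasFDerivAt d3 d4, canonicalPB_eq_of_hasFDerivAt d4 d5]
  simp only [cmh0, cmh1, cmh2, cmh3, cmh4, cmh5]
  refine ⟨?_, by ring, by ring, by ring, by ring, by ring, by ring, by ring⟩
  field_simp
  ring
end
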